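/- Let γ ∈ [−3, 1]. For all Schwartz functions f, g, h : ℝ³ → ℝ, the Landau collision operator satisfies the integration-by-parts identity ∫_{ℝ³} Q(f, g)(v) h(v) dv = ∑_{i,j=1}^{3} ∫_{ℝ³} (φ^{ij} * f)(v) · g(v) · ∂_{v_i} ∂_{v_j} h(v) dv − 4 ∑_{i=1}^{3} ∫_{ℝ³} (ψ_i * f)(v) · g(v) · ∂_{v_i} h(v) dv, where ψ_i(u) := |u|^{γ} u_i and * denotes convolution on ℝ³. -/

import Mathlib

open MeasureTheory Classical

noncomputable section

/-- Partial derivative in the `i`-th coordinate direction. -/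
def pd (i : Fin 3) (g : EuclideanSpace ℝ (Fin 3) → ℝ) : EuclideanSpace ℝ (Fin 3) → ℝ :=
  fun v => fderiv ℝ g v (EuclideanSpace.single i 1)

/-- The Landau kernel matrix `φ^{ij}(u) = |u|^(γ+2) (δ_{ij} - uᵢuⱼ/|u|²)` (set to `0` at `u = 0`). -/
def phiK (γ : ℝ) (i j : Fin 3) (u : EuclideanSpace ℝ (Fin 3)) : ℝ :=
  if u = 0 then 0 else ‖u‖ ^ (γ + 2) * ((if i = j then 1 else 0) - u i * u j / ‖u‖ ^ 2)

/-- The vector kernel `ψᵢ(u) = |u|^γ uᵢ`. -/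
def psiK (γ : ℝ) (i : Fin 3) (u : EuclideanSpace ℝ (Fin 3)) : ℝ := ‖u‖ ^ γ * u i

/-- The Landau collision operator
`Q(f,g)(v) = ∑_{i,j} ∂_{v_i} ∫ φ^{ij}(v-v_*) (f(v_*) ∂_{v_j} g(v) - g(v) (∂_j f)(v_*)) dv_*`. -/
def landauQ (γ : ℝ) (f g : EuclideanSpace ℝ (Fin 3) → ℝ) (v : EuclideanSpace ℝ (Fin 3)) : ℝ :=
  ∑ i : Fin 3, ∑ j : Fin 3,
    pd i (fun v' => ∫ vs, phiK γ i j (v' - vs) * (f vs * pd j g v' - g v' * pd j f vs)) v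

open SchwartzMap Filter
open scoped Topology LineDeriv ContDiff

local notation "E3" => EuclideanSpace ℝ (Fin 3)

/-- A kernel that is integrable against some negative power of `1 + ‖w‖`. -/
def IsTemperedKernel (K : E3 → ℝ) : Prop :=
  AEStronglyMeasurable K volume ∧ ∃ N : ℕ, Integrable fun w => ‖K w‖ * ((1 + ‖w‖) ^ N)⁻¹

/-- The convolution of a scalar kernel with a function. -/
def kconv {F : Type*} [NormedAddCommGroup F] [NormedSpace ℝ F] (K : E3 → ℝ) (f : E3 → F)
    (v : E3) : F :=
  ∫ w, K w • f (v - w)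

section Convolution

variable {F : Type*} [NormedAddCommGroup F] [NormedSpace ℝ F] {K : E3 → ℝ}

theorem SchwartzMap.exists_norm_sub_le (f : SchwartzMap E3 F) (N : ℕ) :
    ∃ C, 0 ≤ C ∧ ∀ v w, ‖f (v - w)‖ ≤ C * (1 + ‖v‖) ^ N * ((1 + ‖w‖) ^ N)⁻¹ := by
  set C := 2 ^ N * (Finset.Iic (N, 0)).sup (fun m => SchwartzMap.seminorm ℝ m.1 m.2) f
  have hC (x : E3) : (1 + ‖x‖) ^ N * ‖f x‖ ≤ C := by
    simpa using one_add_le_sup_seminorm_apply (𝕜 := ℝ) (m := (N, 0)) (k := N) (n := 0)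
      le_rfl le_rfl f x
  refine ⟨C, le_trans (by positivity) (hC 0), fun v w => ?_⟩
  rw [← div_eq_mul_inv, le_div_iff₀ (by positivity)]
  have hw : 1 + ‖w‖ ≤ (1 + ‖v‖) * (1 + ‖v - w‖) := by
    have := norm_sub_le v (v - w)
    rw [sub_sub_cancel] at this
    nlinarith [norm_nonneg v, norm_nonneg (v - w)]
  calc ‖f (v - w)‖ * (1 + ‖w‖) ^ N
      ≤ ‖f (v - w)‖ * ((1 + ‖v‖) * (1 + ‖v - w‖)) ^ N := by gcongr
    _ = ((1 + ‖v - w‖) ^ N * ‖f (v - w)‖) * (1 + ‖v‖) ^ N := by rw [mul_pow]; ring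
    _ ≤ C * (1 + ‖v‖) ^ N := by gcongr; exact hC _

theorem IsTemperedKernel.integrable_smul (hK : IsTemperedKernel K) (f : SchwartzMap E3 F)
    (v : E3) : Integrable fun w => K w • f (v - w) := by
  obtain ⟨hm, N, hN⟩ := hK
  obtain ⟨C, -, hC⟩ := f.exists_norm_sub_le N
  refine (hN.const_mul (C * (1 + ‖v‖) ^ N)).mono'
    (hm.smul (f.continuous.comp (continuous_const.sub continuous_id)).aestronglyMeasurable)
    (.of_forall fun w => ?_)
  rw [norm_smul]
  grw [hC v w]
  exact le_of_eq (by ring)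

theorem IsTemperedKernel.exists_norm_kconv_le (hK : IsTemperedKernel K) (f : SchwartzMap E3 F) :
    ∃ (N : ℕ) (C : ℝ), ∀ v, ‖kconv K f v‖ ≤ C * (1 + ‖v‖) ^ N := by
  obtain ⟨hm, N, hN⟩ := hK
  obtain ⟨C, -, hC⟩ := f.exists_norm_sub_le N
  refine ⟨N, C * ∫ w, ‖K w‖ * ((1 + ‖w‖) ^ N)⁻¹, fun v => ?_⟩
  refine (norm_integral_le_of_norm_le (hN.const_mul (C * (1 + ‖v‖) ^ N))
    (.of_forall fun w => ?_)).trans_eq ?_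
  · rw [norm_smul]
    grw [hC v w]
    exact le_of_eq (by ring)
  · rw [integral_const_mul]
    ring

theorem IsTemperedKernel.hasFDerivAt_kconv (hK : IsTemperedKernel K) (f : SchwartzMap E3 F)
    (v : E3) : HasFDerivAt (kconv K f) (kconv K (fderivCLM ℝ E3 F f) v) v := by
  have hint := hK.integrable_smul f
  have hint' := hK.integrable_smul (fderivCLM ℝ E3 F f)
  obtain ⟨hm, N, hN⟩ := hK
  obtain ⟨C, hC0, hC⟩ := (fderivCLM ℝ E3 F f).exists_norm_sub_le N
  refine hasFDerivAt_integral_of_dominated_of_fderiv_le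
    (F' := fun x w => K w • fderivCLM ℝ E3 F f (x - w)) (Metric.ball_mem_nhds v one_pos)
    (.of_forall fun x => (hint x).aestronglyMeasurable) (hint v)
    (hint' v).aestronglyMeasurable (.of_forall fun w x hx => ?_)
    (hN.const_mul (C * (2 + ‖v‖) ^ N)) (.of_forall fun w x _ => ?_)
  · have hx' : 1 + ‖x‖ ≤ 2 + ‖v‖ := by
      have := norm_le_norm_add_norm_sub' x v
      rw [mem_ball_iff_norm] at hx
      linarith
    rw [norm_smul]
    grw [hC x w, hx']
    exact le_of_eq (by ring)
  · have := (f.hasFDerivAt (x - w)).comp x ((hasFDerivAt_id x).sub_const w)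
    exact this.fun_const_smul (K w)

end Convolution

/-- The `i`-th partial derivative as a Schwartz function. -/
def spd (i : Fin 3) (f : SchwartzMap E3 ℝ) : SchwartzMap E3 ℝ :=
  ∂_{(EuclideanSpace.single i 1 : E3)} f

theorem coe_spd (i : Fin 3) (f : SchwartzMap E3 ℝ) : ⇑(spd i f) = pd i f := rfl

variable {K : E3 → ℝ}

theorem IsTemperedKernel.differentiable_kconv (hK : IsTemperedKernel K) (f : SchwartzMap E3 ℝ) :
    Differentiable ℝ (kconv K f) := fun v => (hK.hasFDerivAt_kconv f v).differentiableAt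

theorem IsTemperedKernel.pd_kconv (hK : IsTemperedKernel K) (f : SchwartzMap E3 ℝ) (i : Fin 3) :
    pd i (kconv K f) = kconv K (spd i f) := by
  funext v
  rw [pd, (hK.hasFDerivAt_kconv f v).fderiv, kconv,
    ContinuousLinearMap.integral_apply (hK.integrable_smul (fderivCLM ℝ E3 ℝ f) v)]
  rfl

theorem IsTemperedKernel.integrable_kconv_mul (hK : IsTemperedKernel K)
    (f g : SchwartzMap E3 ℝ) : Integrable fun v => kconv K f v * g v := by
  obtain ⟨N, C, hC⟩ := hK.exists_norm_kconv_le f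
  have hg := g.hasTemperateGrowth
  have hint : Integrable fun v => (1 + ‖v‖ ^ 2) ^ (N : ℝ) * g v := by
    have := (smulLeftCLM ℝ (fun v : E3 => (1 + ‖v‖ ^ 2) ^ (N : ℝ)) g).integrable (μ := volume)
    refine this.congr (.of_forall fun v => ?_)
    simp only
    rw [smulLeftCLM_apply_apply (by fun_prop), smul_eq_mul]
  refine (hint.norm.const_mul (|C| * 2 ^ N)).mono'
    ((hK.differentiable_kconv f).continuous.mul g.continuous).aestronglyMeasurable
    (.of_forall fun v => ?_)
  have h1 : (1 + ‖v‖) ^ N ≤ 2 ^ N * (1 + ‖v‖ ^ 2) ^ N := by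
    rw [← mul_pow]
    gcongr
    nlinarith [sq_nonneg (‖v‖ - 1 / 2)]
  rw [norm_mul, norm_mul, Real.rpow_natCast,
    Real.norm_of_nonneg (by positivity : 0 ≤ (1 + ‖v‖ ^ 2) ^ N)]
  grw [hC v, le_abs_self C, h1]
  exact le_of_eq (by ring)

theorem IsTemperedKernel.integrable_kconv_mul_mul (hK : IsTemperedKernel K)
    (f g h : SchwartzMap E3 ℝ) : Integrable fun v => kconv K f v * g v * h v := by
  obtain ⟨C, -, hC⟩ := h.exists_norm_sub_le 0
  refine (hK.integrable_kconv_mul f g).mul_bdd (c := C) h.continuous.aestronglyMeasurable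
    (.of_forall fun v => ?_)
  simpa using hC v 0

theorem pd_mul {a b : E3 → ℝ} {v : E3} (i : Fin 3) (ha : DifferentiableAt ℝ a v)
    (hb : DifferentiableAt ℝ b v) :
    pd i (fun x => a x * b x) v = pd i a v * b v + a v * pd i b v := by
  simp only [pd, fderiv_fun_mul ha hb]
  simp
  ring

theorem pd_sub {a b : E3 → ℝ} {v : E3} (i : Fin 3) (ha : DifferentiableAt ℝ a v)
    (hb : DifferentiableAt ℝ b v) :
    pd i (fun x => a x - b x) v = pd i a v - pd i b v := by
  simp [pd, fderiv_fun_sub ha hb]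

theorem IsTemperedKernel.pd_kconv_mul (hK : IsTemperedKernel K)
    (f g : SchwartzMap E3 ℝ) (i : Fin 3) (v : E3) :
    pd i (fun x => kconv K f x * g x) v = kconv K (spd i f) v * g v + kconv K f v * spd i g v := by
  rw [pd_mul i (hK.differentiable_kconv f v) g.differentiableAt, hK.pd_kconv, ← coe_spd i g]

theorem IsTemperedKernel.integral_kconv_mul_mul_spd (hK : IsTemperedKernel K)
    (f g h : SchwartzMap E3 ℝ) (k : Fin 3) :
    ∫ v, kconv K f v * g v * spd k h v =
      -(∫ v, kconv K (spd k f) v * g v * h v) - ∫ v, kconv K f v * spd k g v * h v := by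
  have h1 := hK.integrable_kconv_mul_mul (spd k f) g h
  have h2 := hK.integrable_kconv_mul_mul f (spd k g) h
  have hpd (v : E3) : pd k (fun x => kconv K f x * g x) v * h v =
      kconv K (spd k f) v * g v * h v + kconv K f v * spd k g v * h v := by
    rw [hK.pd_kconv_mul, add_mul]
  have key := integral_mul_fderiv_eq_neg_fderiv_mul_of_integrable (μ := (volume : Measure E3))
    (f := fun x => kconv K f x * g x) (g := h) (v := EuclideanSpace.single k 1)
    ((h1.add h2).congr (.of_forall fun v => (hpd v).symm))
    (hK.integrable_kconv_mul_mul f g (spd k h)) (hK.integrable_kconv_mul_mul f g h)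
    (fun v _ => (hK.differentiable_kconv f v).mul g.differentiableAt)
    (fun v _ => h.differentiableAt)
  refine key.trans ?_
  rw [← neg_add', ← integral_add h1 h2]
  exact congrArg _ (integral_congr_ae (.of_forall hpd))

/-- Integration by parts for one entry of the collision operator. -/
theorem IsTemperedKernel.integral_pd_flux_mul (hK : IsTemperedKernel K)
    (f g h : SchwartzMap E3 ℝ) (i j : Fin 3) :
    Integrable (fun v =>
      pd i (fun x => kconv K f x * spd j g x - kconv K (spd j f) x * g x) v * h v) ∧
    ∫ v, pd i (fun x => kconv K f x * spd j g x - kconv K (spd j f) x * g x) v * h v =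
      (∫ v, kconv K f v * g v * spd j (spd i h) v) +
        2 * ∫ v, kconv K (spd j f) v * g v * spd i h v := by
  have hpd : (fun v =>
      pd i (fun x => kconv K f x * spd j g x - kconv K (spd j f) x * g x) v * h v) = fun v =>
      (kconv K (spd i f) v * spd j g v * h v + kconv K f v * spd i (spd j g) v * h v) -
      (kconv K (spd i (spd j f)) v * g v * h v + kconv K (spd j f) v * spd i g v * h v) := by
    funext v
    rw [pd_sub i ((hK.differentiable_kconv f v).fun_mul (spd j g).differentiableAt)
      ((hK.differentiable_kconv (spd j f) v).fun_mul g.differentiableAt),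
      hK.pd_kconv_mul, hK.pd_kconv_mul]
    ring
  have h1 := hK.integrable_kconv_mul_mul (spd i f) (spd j g) h
  have h2 := hK.integrable_kconv_mul_mul f (spd i (spd j g)) h
  have h3 := hK.integrable_kconv_mul_mul (spd i (spd j f)) g h
  have h4 := hK.integrable_kconv_mul_mul (spd j f) (spd i g) h
  rw [hpd]
  refine ⟨(h1.add h2).sub (h3.add h4), ?_⟩
  have e0 := integral_sub (h1.add h2) (h3.add h4)
  simp only [Pi.add_apply] at e0
  rw [e0, integral_add h1 h2, integral_add h3 h4]
  have e1 := hK.integral_kconv_mul_mul_spd f (spd j g) h i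
  have e2 := hK.integral_kconv_mul_mul_spd (spd j f) g h i
  have e3 := hK.integral_kconv_mul_mul_spd f g (spd i h) j
  linarith

/-- The weight dominating the Landau kernels and their regularisations. -/
def landauWeight (γ : ℝ) (w : E3) : ℝ := (‖w‖ ^ γ + (1 + ‖w‖)) * (‖w‖ * (1 + ‖w‖))

theorem landauWeight_nonneg (γ : ℝ) (w : E3) : 0 ≤ landauWeight γ w := by
  unfold landauWeight
  positivity

theorem isTemperedKernel_landauWeight {γ : ℝ} (hγ : γ ∈ Set.Icc (-3 : ℝ) 1) :
    IsTemperedKernel (landauWeight γ) := by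
  have hmeas : Measurable (landauWeight γ) := by
    unfold landauWeight
    fun_prop
  refine ⟨hmeas.aestronglyMeasurable, 7, ?_⟩
  simp_rw [Real.norm_of_nonneg (landauWeight_nonneg γ _)]
  refine (integrable_fun_norm_addHaar (volume : Measure E3) (f := fun r : ℝ =>
    (r ^ γ + (1 + r)) * (r * (1 + r)) * ((1 + r) ^ 7)⁻¹)).2 ?_
  have hint := (integrableOn_add_rpow_Ioi_of_lt (a := -2) (c := 0) (m := 1)
    (by norm_num) (by norm_num)).const_mul 2
  refine Integrable.mono' hint (Measurable.aestronglyMeasurable (by fun_prop))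
    ((ae_restrict_iff' measurableSet_Ioi).2 (.of_forall fun r (hr : 0 < r) => ?_))
  have h1 : r ^ 3 * r ^ γ ≤ (1 + r) ^ 4 := by
    rw [← Real.rpow_natCast r 3, ← Real.rpow_add hr, ← Real.rpow_natCast (1 + r) 4]
    have h3 := hγ.1
    have h4 := hγ.2
    calc r ^ (((3 : ℕ) : ℝ) + γ) ≤ (1 + r) ^ (((3 : ℕ) : ℝ) + γ) :=
          Real.rpow_le_rpow hr.le (by linarith) (by push_cast; linarith)
      _ ≤ _ := Real.rpow_le_rpow_of_exponent_le (by linarith) (by push_cast; linarith)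
  have h2 : r ^ 3 * (1 + r) ≤ (1 + r) ^ 4 := by
    rw [pow_succ (1 + r) 3]
    gcongr
    linarith
  rw [finrank_euclideanSpace_fin, Real.norm_of_nonneg (by positivity), smul_eq_mul]
  have h5 : (r + 1) ^ (-2 : ℝ) = ((1 + r) ^ 2)⁻¹ := by
    rw [Real.rpow_neg (by positivity), add_comm]
    norm_cast
  rw [h5]
  calc r ^ (3 - 1) * ((r ^ γ + (1 + r)) * (r * (1 + r)) * ((1 + r) ^ 7)⁻¹)
      = (r ^ 3 * r ^ γ + r ^ 3 * (1 + r)) * (1 + r) * ((1 + r) ^ 7)⁻¹ := by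
        simp only [Nat.add_one_sub_one]; ring
    _ ≤ ((1 + r) ^ 4 + (1 + r) ^ 4) * (1 + r) * ((1 + r) ^ 7)⁻¹ := by gcongr
    _ = 2 * ((1 + r) ^ 2)⁻¹ := by field_simp; ring

theorem IsTemperedKernel.of_le {L : E3 → ℝ} (hL : IsTemperedKernel L)
    (hK : AEStronglyMeasurable K) {C : ℝ} (h : ∀ w, ‖K w‖ ≤ C * ‖L w‖) : IsTemperedKernel K := by
  obtain ⟨-, N, hN⟩ := hL
  have hpow : Continuous fun w : E3 => ((1 + ‖w‖) ^ N)⁻¹ :=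
    Continuous.inv₀ (by fun_prop) fun w => by positivity
  refine ⟨hK, N, (hN.const_mul C).mono' (hK.norm.mul hpow.aestronglyMeasurable)
    (.of_forall fun w => ?_)⟩
  rw [Real.norm_of_nonneg (by positivity), ← mul_assoc]
  gcongr
  exact h w

theorem IsTemperedKernel.integrable_mul (hK : IsTemperedKernel K) (f : SchwartzMap E3 ℝ) :
    Integrable fun w => K w * f w := by
  obtain ⟨C, -, hC⟩ := f.exists_norm_sub_le hK.2.choose
  refine (hK.2.choose_spec.const_mul C).mono' (hK.1.mul f.continuous.aestronglyMeasurable)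
    (.of_forall fun w => ?_)
  have := hC 0 (-w)
  simp only [sub_neg_eq_add, zero_add, norm_zero, add_zero, one_pow, mul_one, norm_neg] at this
  rw [norm_mul]
  grw [this]
  exact le_of_eq (by ring)

/-- The kernel `‖u‖ ^ γ * p u` regularised at the origin. -/
def regKernel (γ : ℝ) (p : E3 → ℝ) (ε : ℝ) (u : E3) : ℝ := (ε ^ 2 + ‖u‖ ^ 2) ^ (γ / 2) * p u

theorem hasTemperateGrowth_sq_add_norm_sq_rpow {ε : ℝ} (hε : 0 < ε) (r : ℝ) :
    (fun u : E3 => (ε ^ 2 + ‖u‖ ^ 2) ^ r).HasTemperateGrowth := by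
  have h1 : (fun u : E3 => (1 + ‖ε⁻¹ • u‖ ^ 2) ^ r).HasTemperateGrowth :=
    (Function.hasTemperateGrowth_one_add_norm_sq_rpow E3 r).comp
      (ContinuousLinearMap.hasTemperateGrowth (ε⁻¹ • ContinuousLinearMap.id ℝ E3))
  have h2 : (fun u : E3 => (ε ^ 2 + ‖u‖ ^ 2) ^ r) =
      fun u => (ε ^ 2) ^ r * (1 + ‖ε⁻¹ • u‖ ^ 2) ^ r := by
    funext u
    rw [← Real.mul_rpow (by positivity) (by positivity), norm_smul, norm_inv,
      Real.norm_of_nonneg hε.le]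
    congr 1
    field_simp
  rw [h2]
  exact (Function.HasTemperateGrowth.const _).mul h1

theorem sq_add_norm_sq_rpow_le {γ ε : ℝ} (hγ : γ ≤ 1) (hε : ε ∈ Set.Icc (0 : ℝ) 1) {u : E3}
    (hu : u ≠ 0) : (ε ^ 2 + ‖u‖ ^ 2) ^ (γ / 2) ≤ ‖u‖ ^ γ + (1 + ‖u‖) := by
  have hu' : 0 < ‖u‖ := norm_pos_iff.2 hu
  have hε2 : ε ^ 2 ≤ 1 := by nlinarith [hε.1, hε.2]
  rcases le_total γ 0 with h | h
  · calc (ε ^ 2 + ‖u‖ ^ 2) ^ (γ / 2) ≤ (‖u‖ ^ 2) ^ (γ / 2) :=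
          Real.rpow_le_rpow_of_nonpos (by positivity) (by nlinarith) (by linarith)
      _ = ‖u‖ ^ γ := by
          rw [← Real.rpow_natCast, ← Real.rpow_mul hu'.le]
          congr 1
          push_cast
          ring
      _ ≤ _ := by linarith
  · have hpos : 0 ≤ ‖u‖ ^ γ := by positivity
    calc (ε ^ 2 + ‖u‖ ^ 2) ^ (γ / 2) ≤ ((1 + ‖u‖) ^ 2) ^ (γ / 2) :=
          Real.rpow_le_rpow (by positivity) (by nlinarith) (by linarith)
      _ = (1 + ‖u‖) ^ γ := by
          rw [← Real.rpow_natCast, ← Real.rpow_mul (by positivity)]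
          congr 1
          push_cast
          ring
      _ ≤ (1 + ‖u‖) ^ (1 : ℝ) := Real.rpow_le_rpow_of_exponent_le (by linarith) hγ
      _ ≤ _ := by rw [Real.rpow_one]; linarith

theorem norm_regKernel_le {γ ε : ℝ} (hγ : γ ≤ 1) (hε : ε ∈ Set.Icc (0 : ℝ) 1) {p : E3 → ℝ}
    (hp : ∀ u, ‖p u‖ ≤ 2 * (‖u‖ * (1 + ‖u‖))) (u : E3) :
    ‖regKernel γ p ε u‖ ≤ 2 * landauWeight γ u := by
  rw [regKernel, norm_mul, Real.norm_of_nonneg (by positivity)]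
  rcases eq_or_ne u 0 with rfl | hu
  · have := hp 0
    simp only [norm_zero, zero_mul, mul_zero] at this
    rw [le_antisymm this (norm_nonneg _), mul_zero]
    exact mul_nonneg zero_le_two (landauWeight_nonneg γ 0)
  · grw [sq_add_norm_sq_rpow_le hγ hε hu, hp u]
    exact le_of_eq (by rw [landauWeight]; ring)

theorem regKernel_zero (γ : ℝ) (p : E3 → ℝ) (u : E3) : regKernel γ p 0 u = ‖u‖ ^ γ * p u := by
  rw [regKernel, zero_pow two_ne_zero, zero_add, ← Real.rpow_natCast,
    ← Real.rpow_mul (norm_nonneg u)]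
  congr 2
  push_cast
  ring

theorem isTemperedKernel_rpow_mul {γ : ℝ} (hγ : γ ∈ Set.Icc (-3 : ℝ) 1) {p : E3 → ℝ}
    (hp : ∀ u, ‖p u‖ ≤ 2 * (‖u‖ * (1 + ‖u‖))) (hpc : Continuous p) :
    IsTemperedKernel fun u => ‖u‖ ^ γ * p u := by
  refine (isTemperedKernel_landauWeight hγ).of_le (C := 2)
    (Measurable.aestronglyMeasurable (by fun_prop)) fun w => ?_
  rw [Real.norm_of_nonneg (landauWeight_nonneg γ w), ← regKernel_zero]
  exact norm_regKernel_le hγ.2 ⟨le_rfl, zero_le_one⟩ hp w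

theorem tendsto_integral_regKernel_mul {γ : ℝ} (hγ : γ ∈ Set.Icc (-3 : ℝ) 1) {p : E3 → ℝ}
    (hp : ∀ u, ‖p u‖ ≤ 2 * (‖u‖ * (1 + ‖u‖))) (hpc : Continuous p) (φ : SchwartzMap E3 ℝ) :
    Tendsto (fun n : ℕ => ∫ u, regKernel γ p (1 / ((n : ℝ) + 1)) u * φ u) atTop
      (𝓝 (∫ u, ‖u‖ ^ γ * p u * φ u)) := by
  refine tendsto_integral_of_dominated_convergence (fun u => 2 * ‖landauWeight γ u * φ u‖)
    (fun n => ?_) (((isTemperedKernel_landauWeight hγ).integrable_mul φ).norm.const_mul 2)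
    (fun n => .of_forall fun u => ?_) ?_
  · exact Measurable.aestronglyMeasurable
      (.mul (by unfold regKernel; fun_prop) φ.continuous.measurable)
  · rw [norm_mul, norm_mul, Real.norm_of_nonneg (landauWeight_nonneg γ u), ← mul_assoc]
    gcongr
    refine norm_regKernel_le hγ.2 ⟨by positivity, ?_⟩ hp u
    exact div_le_one_of_le₀ (by linarith [n.cast_nonneg (α := ℝ)]) (by positivity)
  · filter_upwards [compl_mem_ae_iff.2 (measure_singleton (0 : E3))] with u hu
    have hu' : 0 < ‖u‖ := norm_pos_iff.2 hu
    rw [← regKernel_zero]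
    have hcont : ContinuousAt (fun ε : ℝ => regKernel γ p ε u * φ u) 0 := by
      unfold regKernel
      refine ((ContinuousAt.rpow_const (by fun_prop) (.inl ?_)).mul_const _).mul_const _
      positivity
    exact hcont.tendsto.comp tendsto_one_div_add_atTop_nhds_zero_nat

theorem Function.HasTemperateGrowth.integral_mul_spd {T : E3 → ℝ} (hT : T.HasTemperateGrowth)
    (φ : SchwartzMap E3 ℝ) (j : Fin 3) :
    Integrable (fun u => pd j T u * φ u) ∧
      ∫ u, T u * spd j φ u = -∫ u, pd j T u * φ u := by
  have hTd : Differentiable ℝ T := hT.1.differentiable (by simp)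
  have hint (χ : SchwartzMap E3 ℝ) : Integrable fun u => T u * χ u := by
    refine ((smulLeftCLM ℝ T χ).integrable (μ := volume)).congr (.of_forall fun u => ?_)
    simp only
    rw [smulLeftCLM_apply_apply hT, smul_eq_mul]
  have hder : Integrable fun u => pd j T u * φ u := by
    refine (((spd j (smulLeftCLM ℝ T φ)).integrable (μ := volume)).sub (hint (spd j φ))).congr
      (.of_forall fun u => ?_)
    have h1 : ⇑(smulLeftCLM ℝ T φ) = fun u => T u * φ u := by
      funext u
      rw [smulLeftCLM_apply_apply hT, smul_eq_mul]
    simp only [coe_spd, h1, Pi.sub_apply, pd_mul j (hTd u) φ.differentiableAt]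
    ring
  exact ⟨hder, integral_mul_fderiv_eq_neg_fderiv_mul_of_integrable hder (hint (spd j φ)) (hint φ)
    (fun u _ => hTd u) (fun u _ => φ.differentiableAt)⟩

/-- The polynomial part of the Landau kernel. -/
def landauPoly (i j : Fin 3) (u : E3) : ℝ := (if i = j then 1 else 0) * ‖u‖ ^ 2 - u i * u j

theorem hasTemperateGrowth_coord (i : Fin 3) : (fun u : E3 => u i).HasTemperateGrowth :=
  (EuclideanSpace.proj i : E3 →L[ℝ] ℝ).hasTemperateGrowth

theorem hasTemperateGrowth_landauPoly (i j : Fin 3) : (landauPoly i j).HasTemperateGrowth :=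
  ((Function.HasTemperateGrowth.const _).mul (Function.hasTemperateGrowth_norm_sq E3)).sub
    ((hasTemperateGrowth_coord i).mul (hasTemperateGrowth_coord j))

theorem norm_coord_le (i : Fin 3) (u : E3) : ‖u i‖ ≤ 2 * (‖u‖ * (1 + ‖u‖)) := by
  have := PiLp.norm_apply_le u i
  nlinarith [norm_nonneg u]

theorem norm_landauPoly_le (i j : Fin 3) (u : E3) :
    ‖landauPoly i j u‖ ≤ 2 * (‖u‖ * (1 + ‖u‖)) := by
  have h1 : ‖(if i = j then 1 else 0 : ℝ)‖ ≤ 1 := by split_ifs <;> simp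
  unfold landauPoly
  grw [norm_sub_le, norm_mul, norm_mul, h1, PiLp.norm_apply_le u i, PiLp.norm_apply_le u j]
  rw [norm_pow, norm_norm]
  nlinarith [norm_nonneg u]

theorem pd_coord (i j : Fin 3) (u : E3) :
    pd j (fun x => x i) u = if i = j then 1 else 0 := by
  have : HasFDerivAt (fun x : E3 => x i) (EuclideanSpace.proj i : E3 →L[ℝ] ℝ) u :=
    (EuclideanSpace.proj i : E3 →L[ℝ] ℝ).hasFDerivAt
  rw [pd, this.fderiv]
  simp

theorem pd_norm_sq (j : Fin 3) (u : E3) : pd j (fun x => ‖x‖ ^ 2) u = 2 * u j := by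
  rw [pd, (hasStrictFDerivAt_norm_sq u).hasFDerivAt.fderiv]
  simp [EuclideanSpace.inner_single_right]

theorem pd_landauPoly (i j k : Fin 3) (u : E3) :
    pd k (landauPoly i j) u = (if i = j then 1 else 0) * (2 * u k) -
      ((if i = k then 1 else 0) * u j + u i * (if j = k then 1 else 0)) := by
  have hc (i : Fin 3) := (hasTemperateGrowth_coord i).1.differentiable (by simp) u
  have hn : DifferentiableAt ℝ (fun x : E3 => ‖x‖ ^ 2) u :=
    (hasStrictFDerivAt_norm_sq u).hasFDerivAt.differentiableAt
  unfold landauPoly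
  rw [pd_sub k (hn.const_mul _) ((hc i).fun_mul (hc j)), pd_mul k (hc i) (hc j),
    pd_mul k (differentiableAt_const _) hn, pd_coord, pd_coord, pd_norm_sq]
  simp [pd]

theorem pd_sq_add_norm_sq_rpow {ε : ℝ} (hε : 0 < ε) (r : ℝ) (j : Fin 3) (u : E3) :
    pd j (fun x => (ε ^ 2 + ‖x‖ ^ 2) ^ r) u =
      2 * r * (ε ^ 2 + ‖u‖ ^ 2) ^ (r - 1) * u j := by
  have h1 := ((hasStrictFDerivAt_norm_sq u).hasFDerivAt.const_add (ε ^ 2)).rpow_const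
    (p := r) (.inl (by positivity))
  rw [pd, h1.fderiv]
  simp [EuclideanSpace.inner_single_right]
  ring

theorem sum_pd_regKernel_landauPoly (γ : ℝ) {ε : ℝ} (hε : 0 < ε) (i : Fin 3) (u : E3) :
    ∑ j, pd j (regKernel γ (landauPoly i j) ε) u = -2 * regKernel γ (fun u => u i) ε u := by
  have hm := (hasTemperateGrowth_sq_add_norm_sq_rpow hε (γ / 2)).1.differentiable (by simp) u
  have hq (j : Fin 3) := (hasTemperateGrowth_landauPoly i j).1.differentiable (by simp) u
  unfold regKernel
  simp_rw [pd_mul _ hm (hq _), pd_sq_add_norm_sq_rpow hε, pd_landauPoly, landauPoly]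
  generalize (ε ^ 2 + ‖u‖ ^ 2) ^ (γ / 2 - 1) = a
  generalize (ε ^ 2 + ‖u‖ ^ 2) ^ (γ / 2) = b
  simp only [EuclideanSpace.norm_sq_eq, Real.norm_eq_abs, sq_abs, Fin.sum_univ_three]
  fin_cases i <;> simp <;> ring

theorem sum_integral_regKernel_mul_spd (γ : ℝ) {ε : ℝ} (hε : 0 < ε) (i : Fin 3)
    (φ : SchwartzMap E3 ℝ) :
    ∑ j, ∫ u, regKernel γ (landauPoly i j) ε u * spd j φ u =
      2 * ∫ u, regKernel γ (fun u => u i) ε u * φ u := by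
  have hT (j : Fin 3) : (regKernel γ (landauPoly i j) ε).HasTemperateGrowth :=
    (hasTemperateGrowth_sq_add_norm_sq_rpow hε (γ / 2)).mul (hasTemperateGrowth_landauPoly i j)
  simp_rw [fun j => ((hT j).integral_mul_spd φ j).2]
  rw [Finset.sum_neg_distrib, ← integral_finsetSum _ fun j _ => ((hT j).integral_mul_spd φ j).1,
    ← integral_neg, ← integral_const_mul]
  refine integral_congr_ae (.of_forall fun u => ?_)
  simp only [← Finset.sum_mul, sum_pd_regKernel_landauPoly γ hε]
  ring

/-- The weak form of `∑ⱼ ∂ⱼ φ^{ij} = -2 ψᵢ`. -/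
theorem sum_integral_rpow_mul_landauPoly_mul_spd {γ : ℝ} (hγ : γ ∈ Set.Icc (-3 : ℝ) 1)
    (i : Fin 3) (φ : SchwartzMap E3 ℝ) :
    ∑ j, ∫ u, ‖u‖ ^ γ * landauPoly i j u * spd j φ u =
      2 * ∫ u, ‖u‖ ^ γ * u i * φ u := by
  have hl := tendsto_finsetSum Finset.univ fun j _ =>
    tendsto_integral_regKernel_mul hγ (norm_landauPoly_le i j)
      (hasTemperateGrowth_landauPoly i j).1.continuous (spd j φ)
  have hr := (tendsto_integral_regKernel_mul hγ (norm_coord_le i)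
    (hasTemperateGrowth_coord i).1.continuous φ).const_mul 2
  refine tendsto_nhds_unique hl (hr.congr fun n => ?_)
  exact (sum_integral_regKernel_mul_spd γ (by positivity) i φ).symm

theorem phiK_eq (γ : ℝ) (i j : Fin 3) :
    phiK γ i j = fun u => ‖u‖ ^ γ * landauPoly i j u := by
  funext u
  rcases eq_or_ne u 0 with rfl | hu
  · simp [phiK, landauPoly]
  · have hu' : 0 < ‖u‖ := norm_pos_iff.2 hu
    rw [phiK, if_neg hu, Real.rpow_add hu', Real.rpow_two, landauPoly]
    split_ifs <;> field_simp

theorem phiK_comm (γ : ℝ) (i j : Fin 3) : phiK γ i j = phiK γ j i := by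
  simp only [phiK_eq, landauPoly, eq_comm (a := i), mul_comm]

theorem isTemperedKernel_phiK {γ : ℝ} (hγ : γ ∈ Set.Icc (-3 : ℝ) 1) (i j : Fin 3) :
    IsTemperedKernel (phiK γ i j) := by
  rw [phiK_eq]
  exact isTemperedKernel_rpow_mul hγ (norm_landauPoly_le i j)
    (hasTemperateGrowth_landauPoly i j).1.continuous

/-- The Schwartz function `w ↦ f (v - w)`. -/
def reflectShift (v : E3) (f : SchwartzMap E3 ℝ) : SchwartzMap E3 ℝ :=
  compCLMOfAntilipschitz ℝ (K := 1) (g := fun w => v - w)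
    ((Function.HasTemperateGrowth.const v).sub Function.HasTemperateGrowth.id')
    (AntilipschitzWith.of_le_mul_dist fun x y => by simp [dist_eq_norm, norm_sub_rev]) f

theorem reflectShift_apply (v : E3) (f : SchwartzMap E3 ℝ) (w : E3) :
    reflectShift v f w = f (v - w) := by
  simp [reflectShift]

theorem spd_reflectShift (v : E3) (f : SchwartzMap E3 ℝ) (j : Fin 3) (w : E3) :
    spd j (reflectShift v f) w = -spd j f (v - w) := by
  have h1 := (f.hasFDerivAt (v - w)).comp w ((hasFDerivAt_id w).const_sub v)
  have h2 : ⇑(reflectShift v f) = ⇑f ∘ (v - ·) := funext (reflectShift_apply v f)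
  rw [coe_spd, pd, h2, h1.fderiv]
  simp [coe_spd, pd]

theorem sum_kconv_phiK_spd {γ : ℝ} (hγ : γ ∈ Set.Icc (-3 : ℝ) 1) (f : SchwartzMap E3 ℝ)
    (i : Fin 3) (v : E3) :
    ∑ j, kconv (phiK γ i j) (spd j f) v = -2 * kconv (psiK γ i) f v := by
  have := sum_integral_rpow_mul_landauPoly_mul_spd hγ i (reflectShift v f)
  simp only [spd_reflectShift, reflectShift_apply, mul_neg, integral_neg,
    Finset.sum_neg_distrib] at this
  simp only [kconv, phiK_eq, smul_eq_mul]
  unfold psiK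
  linarith

theorem integral_kernel_sub_mul (K f : E3 → ℝ) (v : E3) :
    ∫ w, K (v - w) * f w = kconv K f v := by
  rw [kconv, ← integral_sub_left_eq_self _ volume v]
  simp

theorem landauQ_eq {γ : ℝ} (hγ : γ ∈ Set.Icc (-3 : ℝ) 1) (f g : SchwartzMap E3 ℝ) (v : E3) :
    landauQ γ f g v = ∑ i, ∑ j, pd i (fun x => kconv (phiK γ i j) f x * spd j g x -
      kconv (phiK γ i j) (spd j f) x * g x) v := by
  unfold landauQ
  refine Finset.sum_congr rfl fun i _ => Finset.sum_congr rfl fun j _ => ?_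
  congr 1
  funext x
  have hint (χ : SchwartzMap E3 ℝ) : Integrable fun w => phiK γ i j (x - w) * χ w := by
    simpa using ((isTemperedKernel_phiK hγ i j).integrable_smul χ x).comp_sub_left x
  rw [← integral_kernel_sub_mul, ← integral_kernel_sub_mul, ← integral_mul_const,
    ← integral_mul_const, ← integral_sub ((hint f).mul_const _) ((hint (spd j f)).mul_const _)]
  refine integral_congr_ae (.of_forall fun w => ?_)
  simp only [coe_spd]
  ring

/-- For `γ ∈ [-3,1]` and all Schwartz functions `f, g, h`, the Landau collision
operator satisfies the integration-by-parts identity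
`∫ Q(f,g) h = ∑_{i,j} ∫ (φ^{ij} * f) g ∂ᵢ∂ⱼh dv - 4 ∑ᵢ ∫ (ψᵢ * f) g ∂ᵢh dv`,
where `ψᵢ(u) = |u|^γ uᵢ` and `*` denotes convolution on `ℝ³`. -/
theorem landau_collision_integration_by_parts (γ : ℝ) (hγ : γ ∈ Set.Icc (-3 : ℝ) 1)
    (f g h : SchwartzMap (EuclideanSpace ℝ (Fin 3)) ℝ) :
    ∫ v, landauQ γ (⇑f) (⇑g) v * h v =
      (∑ i : Fin 3, ∑ j : Fin 3,
          ∫ v, (∫ vs, phiK γ i j (v - vs) * f vs) * g v * pd i (pd j (⇑h)) v)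
        - 4 * ∑ i : Fin 3,
            ∫ v, (∫ vs, psiK γ i (v - vs) * f vs) * g v * pd i (⇑h) v := by
  simp_rw [integral_kernel_sub_mul]
  have hK := isTemperedKernel_phiK hγ
  have hflux (i j : Fin 3) := (hK i j).integral_pd_flux_mul f g h i j
  have hdiv (i : Fin 3) : ∑ j, ∫ v, kconv (phiK γ i j) (spd j f) v * g v * spd i h v =
      -2 * ∫ v, kconv (psiK γ i) f v * g v * spd i h v := by
    rw [← integral_finsetSum _ fun j _ => (hK i j).integrable_kconv_mul_mul (spd j f) g (spd i h),
      ← integral_const_mul]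
    refine integral_congr_ae (.of_forall fun v => ?_)
    simp only [← Finset.sum_mul, sum_kconv_phiK_spd hγ]
    ring
  have hQ : ∫ v, landauQ γ f g v * h v = ∑ i, ∑ j,
      ((∫ v, kconv (phiK γ i j) f v * g v * spd j (spd i h) v) +
        2 * ∫ v, kconv (phiK γ i j) (spd j f) v * g v * spd i h v) := by
    simp_rw [landauQ_eq hγ, Finset.sum_mul]
    rw [integral_finsetSum _ fun i _ => integrable_finsetSum _ fun j _ => (hflux i j).1]
    refine Finset.sum_congr rfl fun i _ => ?_
    rw [integral_finsetSum _ fun j _ => (hflux i j).1]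
    exact Finset.sum_congr rfl fun j _ => (hflux i j).2
  rw [hQ]
  simp_rw [Finset.sum_add_distrib, ← Finset.mul_sum, hdiv, ← Finset.mul_sum]
  have hsymm (i j : Fin 3) : ∫ v, kconv (phiK γ j i) f v * g v * spd i (spd j h) v =
      ∫ v, kconv (phiK γ i j) f v * g v * pd i (pd j h) v := by
    rw [phiK_comm, coe_spd, coe_spd]
  rw [Finset.sum_comm]
  simp_rw [hsymm, coe_spd]
  ring
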